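/- arXiv:2308.08034 — 5 statements merged into one kernel-verified Lean document; each statement's English description precedes it below -/
import Mathlib

section
/- Fix an integer r ≥ 1 and let s, B, b_0,…,b_{2r+1}, t_k, g_k, w_k be as defined. Then for every integer k with 0 ≤ k ≤ r+1, one has (s_k − 1)·g_k·t_k − 1 = (b_k · b_{k+1} · ⋯ · b_{2r+1−k}) · w_k, where the product b_k⋯b_{2r+1−k} is over all indices j with k ≤ j ≤ 2r+1−k (and equals 1 when k = r+1). -/
/-- Sylvester's sequence: `s 0 = 2`, `s (j+1) = s j * (s j − 1) + 1`;
it begins 2, 3, 7, 43, 1807, …. -/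
def sylv : ℕ → ℕ
  | 0 => 2
  | n + 1 => sylv n * (sylv n - 1) + 1

/-- The alternating sum `B(x₁,…,x_k) = ∑_{j=0}^{k} (−1)^{k−j} x₁⋯x_j`
(the empty product being 1), characterized by `B [] = 1` and
`B (x :: xs) = x * B xs + (−1)^(length (x :: xs))`. -/
def Bsum : List ℤ → ℤ
  | [] => 1
  | x :: xs => x * Bsum xs + (-1) ^ (xs.length + 1)

/-- `Zl r t` is the list of length `2t` formed by concatenating the pairs
`(b_{r+u}, b_{r+1−u})` for `u = 1, …, t`, where `b` are the exponents
defined inductively together with this list. -/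
def Zl (r : ℕ) : ℕ → List ℤ
  | 0 => []
  | t + 1 => Zl r t ++ [1 + ((sylv (r - t) : ℤ) - 1) ^ 2 * Bsum (Zl r t), (sylv (r - t) : ℤ)]

/-- The exponents `b_0, …, b_{2r+1}`: `b_j = s_j` for `j ≤ r`, and
`b_{r+i} = 1 + (b_{r+1−i} − 1)² · B(Z_{i−1})` for `1 ≤ i ≤ r+1`
(here, for `j = r + i`, one has `b_{r+1−i} = s_{2r+1−j}`). -/
def bexp (r j : ℕ) : ℤ :=
  if j ≤ r then (sylv j : ℤ)
  else 1 + ((sylv (2 * r + 1 - j) : ℤ) - 1) ^ 2 * Bsum (Zl r (j - r - 1))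

/-- The list `L_k = (b_{r+1}, b_r, b_{r+2}, b_{r−1}, …, b_{2r+1−k}, b_k)`,
formed by concatenating the pairs `(b_{r+t}, b_{r+1−t})` for `t = 1, …, r+1−k`. -/
def Lk (r k : ℕ) : List ℤ := Zl r (r + 1 - k)

/-- `t_k := B(L_k)`. -/
def tB (r k : ℕ) : ℤ := Bsum (Lk r k)

/-- `g_k := B(reverse of L_k)`. -/
def gB (r k : ℕ) : ℤ := Bsum (Lk r k).reverse

/-- `T_k`: the alternating sum of `B` over the suffixes of `L_k`
(the full list with sign `+`, the empty suffix contributing `+1`). -/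
def TB (r k : ℕ) : ℤ :=
  ∑ m ∈ Finset.range ((Lk r k).length + 1), (-1) ^ m * Bsum ((Lk r k).drop m)

/-- `w_k := (s_k − 1)·T_k − 1`. -/
def wB (r k : ℕ) : ℤ := ((sylv k : ℤ) - 1) * TB r k - 1

theorem Bsum_append_singleton (l : List ℤ) (x : ℤ) :
    Bsum (l ++ [x]) = l.prod * x - Bsum l := by
  induction l with
  | nil => simp [Bsum]; ring
  | cons y l ih =>
    simp only [List.cons_append, Bsum, ih, List.prod_cons, List.length_append,
      List.length_singleton]
    ring

/-- The alternating sum of `Bsum` over the suffixes of a list. -/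
def altSuffixSum (l : List ℤ) : ℤ :=
  ∑ m ∈ Finset.range (l.length + 1), (-1) ^ m * Bsum (l.drop m)

theorem altSuffixSum_nil : altSuffixSum [] = 1 := by
  simp [altSuffixSum, Bsum]

theorem altSuffixSum_cons (x : ℤ) (l : List ℤ) :
    altSuffixSum (x :: l) = Bsum (x :: l) - altSuffixSum l := by
  unfold altSuffixSum
  rw [List.length_cons, Finset.sum_range_succ', sub_eq_neg_add, ← Finset.sum_neg_distrib]
  simp [pow_succ]

theorem altSuffixSum_append_singleton (l : List ℤ) (x : ℤ) :
    altSuffixSum (l ++ [x]) =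
      x * Bsum l.reverse - altSuffixSum l + (-1) ^ (l.length + 1) := by
  induction l with
  | nil => simp [altSuffixSum_cons, altSuffixSum_nil, Bsum]; ring
  | cons y l ih =>
    rw [List.cons_append, altSuffixSum_cons, ih, altSuffixSum_cons, ← List.cons_append,
      Bsum_append_singleton, List.reverse_cons, Bsum_append_singleton, List.prod_reverse,
      List.prod_cons, List.length_cons]
    ring

theorem length_Zl (r t : ℕ) : (Zl r t).length = 2 * t := by
  induction t with
  | zero => rfl
  | succ t ih => simp only [Zl, List.length_append, ih, List.length_cons, List.length_nil]; ring

theorem one_le_sylv (n : ℕ) : 1 ≤ sylv n := by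
  cases n <;> simp [sylv]

theorem sylv_succ_cast (n : ℕ) :
    (sylv (n + 1) : ℤ) = sylv n * ((sylv n : ℤ) - 1) + 1 := by
  simp [sylv, Nat.cast_sub (one_le_sylv n)]

theorem bexp_of_le {r j : ℕ} (h : j ≤ r) : bexp r j = sylv j := if_pos h

theorem bexp_add_succ (r t : ℕ) :
    bexp r (r + t + 1) = 1 + ((sylv (r - t) : ℤ) - 1) ^ 2 * Bsum (Zl r t) := by
  rw [bexp, if_neg (by omega), show 2 * r + 1 - (r + t + 1) = r - t by omega,
    show r + t + 1 - r - 1 = t by omega]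

theorem prod_Zl (r t : ℕ) (ht : t ≤ r + 1) :
    (Zl r t).prod = ∏ j ∈ Finset.Icc (r + 1 - t) (r + t), bexp r j := by
  induction t with
  | zero => simp [Zl]
  | succ t ih =>
    rw [show r + 1 - (t + 1) = r - t by omega, ← add_assoc,
      Finset.prod_Icc_succ_top (by omega),
      ← Finset.mul_prod_Ioc_eq_prod_Icc (by omega : r - t ≤ r + t),
      ← Finset.Icc_add_one_left_eq_Ioc,
      show r - t + 1 = r + 1 - t by omega, ← ih (by omega), bexp_add_succ,
      bexp_of_le (by omega : r - t ≤ r), Zl]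
    simp only [List.prod_append, List.prod_cons, List.prod_nil]
    ring

theorem product_formula_Zl (r t : ℕ) (ht : t ≤ r + 1) :
    ((sylv (r + 1 - t) : ℤ) - 1) * Bsum (Zl r t).reverse * Bsum (Zl r t) - 1 =
      (Zl r t).prod * (((sylv (r + 1 - t) : ℤ) - 1) * altSuffixSum (Zl r t) - 1) := by
  induction t with
  | zero => simp [Zl, Bsum, altSuffixSum_nil]
  | succ t ih =>
    have ih := ih (by omega)
    rw [show r + 1 - t = r - t + 1 by omega, sylv_succ_cast] at ih
    rw [show r + 1 - (t + 1) = r - t by omega, Zl]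
    generalize (sylv (r - t) : ℤ) = c at ih ⊢
    have hlen : (-1 : ℤ) ^ (Zl r t).length = 1 := by simp [length_Zl]
    generalize Zl r t = l at ih hlen ⊢
    generalize ha : 1 + (c - 1) ^ 2 * Bsum l = a
    rw [← List.singleton_append, ← List.append_assoc, altSuffixSum_append_singleton,
      altSuffixSum_append_singleton, Bsum_append_singleton, Bsum_append_singleton]
    simp only [List.reverse_append, List.reverse_singleton, List.singleton_append, Bsum,
      List.length_cons, List.length_append, List.length_reverse, List.length_nil,
      List.prod_append, List.prod_singleton, pow_add, hlen]
    linear_combination a * ih - ha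


/-- Proposition 4.1 of Esser–Totaro: for `0 ≤ k ≤ r+1`,
`(s_k − 1)·g_k·t_k − 1 = b_k b_{k+1} ⋯ b_{2r+1−k} · w_k`. -/
theorem product_formula (r : ℕ) (hr : 1 ≤ r) (k : ℕ) (hk : k ≤ r + 1) :
    ((sylv k : ℤ) - 1) * gB r k * tB r k - 1 =
      (∏ j ∈ Finset.Icc k (2 * r + 1 - k), bexp r j) * wB r k := by
  have hprod := prod_Zl r (r + 1 - k) (by omega)
  have h := product_formula_Zl r (r + 1 - k) (by omega)
  rw [show r + 1 - (r + 1 - k) = k by omega] at h hprod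
  rw [show r + (r + 1 - k) = 2 * r + 1 - k by omega] at hprod
  rw [hprod] at h
  exact h
end

section
/- Fix an integer r ≥ 1 and let s, B, b_0,…,b_{2r+1}, g_k, w_k be as defined. Then for every integer k with 0 ≤ k ≤ r, one has b_k·w_k − w_{k+1} = (s_k − 1)²·g_k. -/
theorem Bsum_append_pair (l : List ℤ) (a s : ℤ) :
    Bsum (l ++ [a, s]) = l.prod * a * (s - 1) + Bsum l := by
  have h : l ++ [a, s] = (l ++ [a]) ++ [s] := by simp
  rw [h, Bsum_append_singleton, Bsum_append_singleton]
  simp only [List.prod_append, List.prod_singleton]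
  ring

/-- The alternating sum of `Bsum` over the suffixes of a list. -/
def suffixSum (l : List ℤ) : ℤ :=
  ∑ m ∈ Finset.range (l.length + 1), (-1) ^ m * Bsum (l.drop m)

theorem suffixSum_nil : suffixSum [] = 1 := by simp [suffixSum, Bsum]

theorem suffixSum_cons (x : ℤ) (l : List ℤ) :
    suffixSum (x :: l) = Bsum (x :: l) - suffixSum l := by
  simp only [suffixSum, List.length_cons]
  rw [Finset.sum_range_succ']
  simp only [List.drop_succ_cons, pow_succ, mul_neg, mul_one, neg_mul,
    Finset.sum_neg_distrib, pow_zero, List.drop_zero, one_mul]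
  ring

theorem suffixSum_append_pair (l : List ℤ) (a s : ℤ) :
    suffixSum (l ++ [a, s]) =
      suffixSum l + a * (s - 1) * Bsum l.reverse + (-1) ^ l.length * (2 - s) := by
  induction l with
  | nil =>
    simp [suffixSum_cons, suffixSum_nil, Bsum]
    ring
  | cons x l ih =>
    rw [List.cons_append, suffixSum_cons, ih, suffixSum_cons, ← List.cons_append,
      Bsum_append_pair, List.reverse_cons, Bsum_append_singleton, List.prod_reverse,
      List.prod_cons, List.length_cons]
    ring

theorem Bsum_reverse_append_pair (l : List ℤ) (a s : ℤ) :
    Bsum (l ++ [a, s]).reverse =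
      s * (a * Bsum l.reverse + (-1) ^ (l.length + 1)) + (-1) ^ l.length := by
  simp [Bsum]
  ring

theorem sylv_succ_sub_one (k : ℕ) :
    (sylv (k + 1) : ℤ) - 1 = sylv k * ((sylv k : ℤ) - 1) := by
  cases h : sylv k <;> simp [sylv, h]

/-- Equation (4.2) of Esser–Totaro: for `0 ≤ k ≤ r`,
`b_k·w_k − w_{k+1} = (s_k − 1)²·g_k`. -/
theorem bw_identity (r : ℕ) (hr : 1 ≤ r) (k : ℕ) (hk : k ≤ r) :
    bexp r k * wB r k - wB r (k + 1) = ((sylv k : ℤ) - 1) ^ 2 * gB r k := by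
  obtain ⟨a, hL⟩ : ∃ a : ℤ, Lk r k = Lk r (k + 1) ++ [a, (sylv k : ℤ)] := by
    have h₁ : r + 1 - k = (r - k) + 1 := by omega
    have h₂ : r + 1 - (k + 1) = r - k := by omega
    have h₃ : r - (r - k) = k := by omega
    simp only [Lk, h₁, h₂, Zl, h₃]
    exact ⟨_, rfl⟩
  have hlen : (-1 : ℤ) ^ (Lk r (k + 1)).length = 1 := by
    rw [Lk, length_Zl, pow_mul]
    norm_num
  have hT : TB r k = TB r (k + 1) + a * (sylv k - 1) * gB r (k + 1) + (2 - sylv k) := by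
    have h := suffixSum_append_pair (Lk r (k + 1)) a (sylv k)
    rw [← hL, hlen, one_mul] at h
    exact h
  have hg : gB r k = sylv k * (a * gB r (k + 1) - 1) + 1 := by
    have h := Bsum_reverse_append_pair (Lk r (k + 1)) a (sylv k)
    rw [← hL, pow_succ, hlen, one_mul] at h
    exact h
  rw [bexp, if_pos hk, wB, wB, sylv_succ_sub_one, hT, hg]
  ring
end

section
/- Let n ≥ 2 be an integer and set d := s_{n+1} − 1. Then: (i) s_i divides d for every 0 ≤ i ≤ n, and the product of the integers d/s_i over 0 ≤ i ≤ n equals d^n; (ii) d − Σ_{i=0}^{n} d/s_i = 1; (iii) d^{n−1}·(s_n² − s_n + 2) > 2^(2^n + 2) if n is even, and d^{n−1}·(s_n² − 3s_n + 4) > 2^(2^n + 2) if n is odd. (These are the numerical facts behind Theorem 2.1: the hypersurface X of degree d in P^{n+1}(a_0,…,a_{n+1}) with a_i = d/s_i for i ≤ n and a_{n+1} as defined satisfies K_X + B ∼ O_X(1), and vol(K_X + B) = d/(a_0⋯a_{n+1}) = 1/(d^{n−1} a_{n+1}) < 1/2^(2^n).) -/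
theorem prod_range_sylv (n : ℕ) : ∏ i ∈ Finset.range n, sylv i = sylv n - 1 := by
  induction n with
  | zero => rfl
  | succ n ih =>
    rw [Finset.prod_range_succ, ih, sylv, Nat.add_sub_cancel, mul_comm]

theorem two_le_sylv (n : ℕ) : 2 ≤ sylv n := by
  induction n with
  | zero => exact le_rfl
  | succ n ih =>
    have h : 0 < sylv n * (sylv n - 1) := Nat.mul_pos (by omega) (by omega)
    rw [sylv]
    omega

theorem sylv_dvd_sylv_sub_one {i n : ℕ} (h : i < n) : sylv i ∣ sylv n - 1 := by
  rw [← prod_range_sylv]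
  exact Finset.dvd_prod_of_mem _ (Finset.mem_range.2 h)

theorem prod_range_sylv_sub_one_div (n : ℕ) :
    ∏ i ∈ Finset.range (n + 1), (sylv (n + 1) - 1) / sylv i = (sylv (n + 1) - 1) ^ n := by
  have hpos : 0 < sylv (n + 1) - 1 := by have := two_le_sylv (n + 1); omega
  refine Nat.eq_of_mul_eq_mul_right hpos ?_
  rw [← pow_succ]
  nth_rewrite 2 [← prod_range_sylv]
  rw [← Finset.prod_mul_distrib, Finset.prod_congr rfl fun i hi =>
    Nat.div_mul_cancel (sylv_dvd_sylv_sub_one (Finset.mem_range.1 hi))]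
  simp

theorem sum_range_sylv_sub_one_div_add_one (n : ℕ) :
    ∑ i ∈ Finset.range n, (sylv n - 1) / sylv i + 1 = sylv n - 1 := by
  induction n with
  | zero => rfl
  | succ n ih =>
    have h2 := two_le_sylv n
    have hterm : ∀ i ∈ Finset.range n,
        sylv n * (sylv n - 1) / sylv i = sylv n * ((sylv n - 1) / sylv i) := fun i hi =>
      Nat.mul_div_assoc _ (sylv_dvd_sylv_sub_one (Finset.mem_range.1 hi))
    rw [sylv, Nat.add_sub_cancel, Finset.sum_range_succ, Finset.sum_congr rfl hterm,
      ← Finset.mul_sum, Nat.mul_div_cancel_left _ (by omega)]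
    generalize ∑ i ∈ Finset.range n, (sylv n - 1) / sylv i = S at ih
    obtain ⟨m, hm⟩ : ∃ m, sylv n = m + 1 := ⟨sylv n - 1, by omega⟩
    rw [hm, Nat.add_sub_cancel] at ih ⊢
    rw [← ih]
    ring

theorem two_pow_two_pow_lt_sylv {n : ℕ} (hn : 2 ≤ n) : 2 * 2 ^ 2 ^ n < sylv (n + 1) := by
  induction n, hn using Nat.le_induction with
  | base => decide
  | succ n _ ih =>
    obtain ⟨m, hm⟩ : ∃ m, sylv (n + 1) = m + 1 := ⟨sylv (n + 1) - 1, by omega⟩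
    rw [sylv, hm, Nat.add_sub_cancel, pow_succ 2 n, pow_mul]
    rw [hm] at ih
    have hsq := Nat.mul_self_le_mul_self (Nat.le_of_lt_succ ih)
    nlinarith

theorem two_pow_lt_sylv_sub_one_pow_mul {n : ℕ} (hn : 2 ≤ n) {c : ℤ} (hc : 4 ≤ c) :
    2 ^ (2 ^ n + 2) < ((sylv (n + 1) : ℤ) - 1) ^ (n - 1) * c := by
  have h : (2 * 2 ^ 2 ^ n : ℤ) < sylv (n + 1) := by exact_mod_cast two_pow_two_pow_lt_sylv hn
  have hX : (0 : ℤ) < 2 ^ 2 ^ n := by positivity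
  have hd : (sylv (n + 1) : ℤ) - 1 ≤ ((sylv (n + 1) : ℤ) - 1) ^ (n - 1) :=
    le_self_pow₀ (by linarith) (by omega)
  rw [pow_add]
  nlinarith

/-- The numerical facts behind Theorem 2.1 of Esser–Totaro, with `d = s_{n+1} − 1`
and weights `a_i = d/s_i` for `i ≤ n` and `a_{n+1} = (s_n² − s_n + 2)/4` (n even)
or `(s_n² − 3s_n + 4)/4` (n odd): (i) each `s_i` divides `d` and `∏ a_i = d^n`;
(ii) `d − ∑ a_i = 1` (so `K_X + B ∼ O_X(1)`); (iii) `d^{n−1}·(4a_{n+1}) > 2^(2^n+2)`,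
i.e. `vol(K_X + B) = 1/(d^{n−1} a_{n+1}) < 1/2^(2^n)`. -/
theorem small_volume_numerics (n : ℕ) (hn : 2 ≤ n) :
    (∀ i ≤ n, sylv i ∣ sylv (n + 1) - 1) ∧
    (∏ i ∈ Finset.range (n + 1), (sylv (n + 1) - 1) / sylv i) = (sylv (n + 1) - 1) ^ n ∧
    (sylv (n + 1) - 1) - (∑ i ∈ Finset.range (n + 1), (sylv (n + 1) - 1) / sylv i) = 1 ∧
    (Even n →
      ((sylv (n + 1) : ℤ) - 1) ^ (n - 1) * ((sylv n : ℤ) ^ 2 - sylv n + 2) >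
        2 ^ (2 ^ n + 2)) ∧
    (Odd n →
      ((sylv (n + 1) : ℤ) - 1) ^ (n - 1) * ((sylv n : ℤ) ^ 2 - 3 * sylv n + 4) >
        2 ^ (2 ^ n + 2)) := by
  have h2 : (2 : ℤ) ≤ sylv n := by exact_mod_cast two_le_sylv n
  refine ⟨fun i hi => sylv_dvd_sylv_sub_one (Nat.lt_succ_of_le hi),
    prod_range_sylv_sub_one_div n, ?_, fun _ => ?_, fun _ => ?_⟩
  · have := sum_range_sylv_sub_one_div_add_one (n + 1)
    omega
  · exact two_pow_lt_sylv_sub_one_pow_mul hn (by nlinarith)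
  · have h3 : (3 : ℤ) ≤ sylv n := by
      obtain ⟨m, rfl⟩ : ∃ m, n = m + 1 := ⟨n - 1, by omega⟩
      have hm := two_le_sylv m
      have : 2 * 1 ≤ sylv m * (sylv m - 1) := Nat.mul_le_mul hm (by omega)
      rw [sylv]
      omega
    exact two_pow_lt_sylv_sub_one_pow_mul hn (by nlinarith)
end

section
/- Fix an integer r ≥ 1 and let s, B, b_0,…,b_{2r+1}, w_0 be as defined, and set v := w_0. Let A be the (2r+3)×(2r+3) matrix with rational entries, with rows and columns indexed by 0, 1, …, 2r+2, whose entries are: A_{i,i} = b_i for 0 ≤ i ≤ 2r+1 and A_{2r+2,2r+2} = v; A_{i,2r+2−i} = 1 for 0 ≤ i ≤ r; A_{r+1+i,r−i} = 1 for 0 ≤ i ≤ r; A_{2r+2,r+1} = 1; and all other entries 0. Then A is invertible over ℚ and the sum of all (2r+3)² entries of A⁻¹ equals 1. (This is the odd-dimensional case of Lemma 5.2: the sum of the charges of Esser's hypersurface V of dimension n = 2r+1 equals 1, i.e. V is Calabi–Yau.) -/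
/-- The `(2r+3)×(2r+3)` exponent matrix of Esser's hypersurface `V` of odd
dimension `n = 2r+1`: diagonal entries `b_0, …, b_{2r+1}, v` (where `v = w_0`),
together with the entries `A_{i,2r+2−i} = 1` for `0 ≤ i ≤ r`,
`A_{r+1+i,r−i} = 1` for `0 ≤ i ≤ r`, and `A_{2r+2,r+1} = 1`. -/
def esserMatrix (r : ℕ) : Matrix (Fin (2 * r + 3)) (Fin (2 * r + 3)) ℚ :=
  Matrix.of fun i j =>
    if i = j then (if i.val ≤ 2 * r + 1 then (bexp r i.val : ℚ) else (wB r 0 : ℚ))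
    else if i.val ≤ r ∧ i.val + j.val = 2 * r + 2 then 1
    else if r + 1 ≤ i.val ∧ i.val ≤ 2 * r + 1 ∧ i.val + j.val = 2 * r + 1 then 1
    else if i.val = 2 * r + 2 ∧ j.val = r + 1 then 1
    else 0

/-- The alternating sum of `Bsum` over the suffixes of a list. -/
def suffixBsum (L : List ℤ) : ℤ :=
  ∑ m ∈ Finset.range (L.length + 1), (-1) ^ m * Bsum (L.drop m)

/-- The alternating sum of the products of the suffixes of a list. -/
def suffixProd (L : List ℤ) : ℤ :=
  ∑ m ∈ Finset.range (L.length + 1), (-1) ^ m * (L.drop m).prod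

theorem suffixBsum_cons (a : ℤ) (L : List ℤ) :
    suffixBsum (a :: L) = Bsum (a :: L) - suffixBsum L := by
  simp only [suffixBsum, List.length_cons]
  rw [Finset.sum_range_succ']
  simp only [List.drop_succ_cons, pow_succ, List.drop_zero, pow_zero, one_mul, mul_neg, mul_one,
    neg_mul, Finset.sum_neg_distrib]
  ring

theorem suffixProd_cons (a : ℤ) (L : List ℤ) :
    suffixProd (a :: L) = (a :: L).prod - suffixProd L := by
  simp only [suffixProd, List.length_cons]
  rw [Finset.sum_range_succ']
  simp only [List.drop_succ_cons, pow_succ, List.drop_zero, pow_zero, one_mul, mul_neg, mul_one,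
    neg_mul, Finset.sum_neg_distrib]
  ring

theorem Bsum_concat (L : List ℤ) (x : ℤ) : Bsum (L ++ [x]) = L.prod * x - Bsum L := by
  induction L with
  | nil => simp [Bsum, sub_eq_add_neg]
  | cons a L ih =>
    simp only [List.cons_append, Bsum, ih, List.length_append, List.length_cons, List.length_nil,
      List.prod_cons]
    ring

theorem suffixProd_eq_Bsum_reverse (L : List ℤ) : suffixProd L = Bsum L.reverse := by
  induction L with
  | nil => simp [Bsum, suffixProd]
  | cons a L ih =>
    rw [suffixProd_cons, List.reverse_cons, Bsum_concat, ih, List.prod_cons, List.prod_reverse]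
    ring

theorem suffixBsum_concat (L : List ℤ) (x : ℤ) :
    suffixBsum (L ++ [x]) = x * suffixProd L - suffixBsum L + (-1) ^ (L.length + 1) := by
  induction L with
  | nil => simp [Bsum, suffixBsum, suffixProd, Finset.sum_range_succ]; ring
  | cons a L ih =>
    rw [List.cons_append, suffixBsum_cons, ih, suffixBsum_cons, suffixProd_cons,
      ← List.cons_append, Bsum_concat, List.length_cons]
    ring

theorem Bsum_append_pair_s11 (L : List ℤ) (x y : ℤ) :
    Bsum (L ++ [x, y]) = L.prod * x * (y - 1) + Bsum L := by
  rw [← List.singleton_append, ← List.append_assoc, Bsum_concat, Bsum_concat]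
  simp only [List.prod_append, List.prod_singleton]
  ring

theorem Bsum_reverse_append_pair_s11 {L : List ℤ} (hL : Even L.length) (x y : ℤ) :
    Bsum (L ++ [x, y]).reverse = y * (x * Bsum L.reverse - 1) + 1 := by
  have h : (-1 : ℤ) ^ L.length = 1 := hL.neg_one_pow
  simp only [List.reverse_append, List.reverse_cons, List.reverse_nil, List.nil_append,
    List.cons_append, Bsum, List.length_cons, List.length_reverse, pow_succ, h]
  ring

theorem suffixBsum_append_pair {L : List ℤ} (hL : Even L.length) (x y : ℤ) :
    suffixBsum (L ++ [x, y]) = suffixBsum L + (y - 1) * (x * Bsum L.reverse - 1) + 1 := by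
  have h : (-1 : ℤ) ^ L.length = 1 := hL.neg_one_pow
  rw [← List.singleton_append, ← List.append_assoc, suffixBsum_concat, suffixBsum_concat,
    suffixProd_eq_Bsum_reverse, suffixProd_eq_Bsum_reverse]
  simp [Bsum, pow_succ, h]
  ring

theorem cast_sylv_succ (n : ℕ) : (sylv (n + 1) : ℤ) = sylv n * (sylv n - 1) + 1 := by
  have := two_le_sylv n
  simp only [sylv]
  push_cast [Nat.cast_sub (show 1 ≤ sylv n by omega)]
  ring

theorem Zl_pos (r t : ℕ) :
    1 ≤ (Zl r t).prod ∧ 1 ≤ Bsum (Zl r t) ∧ 1 ≤ Bsum (Zl r t).reverse := by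
  induction t with
  | zero => simp [Zl, Bsum]
  | succ t ih =>
    obtain ⟨hP, hB, hG⟩ := ih
    have hs : (2 : ℤ) ≤ sylv (r - t) := by exact_mod_cast two_le_sylv (r - t)
    have hev : Even (Zl r t).length := by simp [length_Zl]
    simp only [Zl]
    rw [Bsum_append_pair_s11, Bsum_reverse_append_pair_s11 hev, List.prod_append]
    simp only [List.prod_cons, List.prod_nil, mul_one]
    generalize Bsum (Zl r t).reverse = g at *
    generalize Bsum (Zl r t) = b at *
    generalize (Zl r t).prod = p at *
    generalize (sylv (r - t) : ℤ) = s at *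
    have hx : 1 ≤ 1 + (s - 1) ^ 2 * b := by
      have : 0 ≤ (s - 1) ^ 2 * b := by positivity
      linarith
    generalize 1 + (s - 1) ^ 2 * b = x at *
    have hxs : 1 ≤ x * s := by nlinarith
    refine ⟨by nlinarith, ?_, ?_⟩
    · have : 0 ≤ p * x * (s - 1) := mul_nonneg (by positivity) (by linarith)
      linarith
    · have : 1 ≤ x * g := by nlinarith
      nlinarith

/-- The key identity relating the prefix product, `Bsum` of the list and of its reverse, and the
alternating sum over suffixes. -/
theorem Zl_identity (r t : ℕ) (ht : t ≤ r + 1) :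
    (((sylv (r + 1 - t) : ℤ) - 1) * suffixBsum (Zl r t) - 1) * (Zl r t).prod + 1 =
      ((sylv (r + 1 - t) : ℤ) - 1) * (Bsum (Zl r t) * Bsum (Zl r t).reverse) := by
  induction t with
  | zero => simp [Zl, Bsum, suffixBsum]
  | succ t ih =>
    have ih := ih (by omega)
    have hev : Even (Zl r t).length := by simp [length_Zl]
    rw [show r + 1 - t = (r - t) + 1 by omega, cast_sylv_succ] at ih
    rw [show r + 1 - (t + 1) = r - t by omega]
    simp only [Zl]
    rw [Bsum_append_pair_s11, Bsum_reverse_append_pair_s11 hev, suffixBsum_append_pair hev,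
      List.prod_append]
    simp only [List.prod_cons, List.prod_nil, mul_one]
    generalize Bsum (Zl r t).reverse = g at *
    generalize Bsum (Zl r t) = b at *
    generalize (Zl r t).prod = p at *
    generalize suffixBsum (Zl r t) = T at *
    generalize (sylv (r - t) : ℤ) = s at *
    linear_combination (1 + (s - 1) ^ 2 * b) * ih

theorem getElem?_Zl (r t u : ℕ) (hu : u < t) :
    (Zl r t)[2 * u]? = some (1 + ((sylv (r - u) : ℤ) - 1) ^ 2 * Bsum (Zl r u)) ∧
      (Zl r t)[2 * u + 1]? = some (sylv (r - u) : ℤ) := by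
  induction t with
  | zero => omega
  | succ t ih =>
    simp only [Zl]
    rcases Nat.lt_succ_iff_lt_or_eq.mp hu with h | rfl
    · rw [List.getElem?_append_left (by rw [length_Zl]; omega),
        List.getElem?_append_left (by rw [length_Zl]; omega)]
      exact ih h
    · rw [List.getElem?_append_right (by rw [length_Zl]),
        List.getElem?_append_right (by rw [length_Zl]; omega)]
      simp [length_Zl]

/-- Invertibility and the sum of the entries of the inverse of a cyclic bidiagonal matrix with
diagonal `v, L` and with entries `1` at the positions `(i, i + 1)`. -/
theorem cyclic_det_ne_zero_and_sum_inv {n : ℕ} {L : List ℤ} (hL : L.length = n) (hn : Even n)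
    (v : ℤ) (C : Matrix (Fin (n + 1)) (Fin (n + 1)) ℚ)
    (h0 : ∀ y, Matrix.vecMul y C 0 = v * y 0 + y (Fin.last n))
    (hS : ∀ y (m : Fin n), Matrix.vecMul y C m.succ =
      (L[m.val]'(hL ▸ m.isLt) : ℤ) * y m.succ + y m.castSucc)
    (hD : (v : ℚ) * L.prod + 1 ≠ 0) :
    C.det ≠ 0 ∧ ∑ i, ∑ j, C⁻¹ i j =
      suffixBsum L - v * Bsum L * Bsum L.reverse / (v * L.prod + 1) := by
  have hdrop : ∀ m : Fin n,
      L.drop m.val = (L[m.val]'(hL ▸ m.isLt)) :: L.drop (m.val + 1) := fun m =>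
    List.drop_eq_getElem_cons (hL ▸ m.isLt)
  have hsign : (-1 : ℚ) ^ n = 1 := hn.neg_one_pow
  have hdet : C.det ≠ 0 := by
    intro hdet
    obtain ⟨z, hz, hzC⟩ := Matrix.exists_vecMul_eq_zero_iff.mpr hdet
    have key : ∀ i : Fin (n + 1),
        z i = (-1) ^ i.val * ((L.drop i.val).prod : ℤ) * z (Fin.last n) := by
      intro i
      induction i using Fin.reverseInduction with
      | last => simp [hsign, List.drop_of_length_le hL.le]
      | cast m ih =>
        have h := hS z m
        rw [hzC, Pi.zero_apply, ih] at h
        rw [Fin.val_castSucc, hdrop m, List.prod_cons, Int.cast_mul]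
        rw [Fin.val_succ, pow_succ] at h
        linear_combination -h
    have h := h0 z
    rw [hzC, Pi.zero_apply, key 0] at h
    simp only [Fin.val_zero, pow_zero, List.drop_zero, one_mul] at h
    have hlast : z (Fin.last n) = 0 := by
      refine (mul_eq_zero.mp (?_ : ((v : ℚ) * L.prod + 1) * z (Fin.last n) = 0)).resolve_left hD
      linear_combination -h
    exact hz (funext fun i => by rw [key i, hlast, mul_zero, Pi.zero_apply])
  refine ⟨hdet, ?_⟩
  set D : ℚ := v * L.prod + 1 with hDdef
  set c : ℚ := v * Bsum L / D with hc
  let y : Fin (n + 1) → ℚ := fun i =>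
    (-1) ^ i.val * ((Bsum (L.drop i.val) : ℚ) - ((L.drop i.val).prod : ℤ) * c)
  have hy : Matrix.vecMul y C = 1 := by
    funext j
    refine Fin.cases ?_ (fun m => ?_) j
    · rw [h0]
      have hl : L.drop n = [] := by simp [← hL]
      simp only [y, Fin.val_zero, Fin.val_last, hl, hsign, Bsum, List.prod_nil, List.drop_zero,
        pow_zero, Pi.one_apply, hc]
      field_simp
      rw [hDdef]
      push_cast
      ring
    · rw [hS]
      have hs : (-1 : ℚ) ^ m.val * (-1) ^ ((L.drop (m.val + 1)).length + 1) = 1 := by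
        rw [← pow_add, List.length_drop, hL,
          show m.val + (n - (m.val + 1) + 1) = n by omega, hsign]
      simp only [y, Fin.val_castSucc, Fin.val_succ, Pi.one_apply]
      rw [hdrop m, Bsum, List.prod_cons]
      push_cast
      rw [pow_succ]
      linear_combination hs
  have hinv : y = Matrix.vecMul 1 C⁻¹ := by
    rw [← hy, Matrix.vecMul_vecMul, Matrix.mul_nonsing_inv _ (isUnit_iff_ne_zero.mpr hdet),
      Matrix.vecMul_one]
  have hsum : ∑ j, y j = (suffixBsum L : ℚ) - suffixProd L * c := by
    simp only [suffixBsum, suffixProd, hL]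
    push_cast
    rw [Finset.sum_range, Finset.sum_range, Finset.sum_mul, ← Finset.sum_sub_distrib]
    refine Finset.sum_congr rfl fun i _ => ?_
    simp only [y]
    push_cast
    ring
  calc ∑ i, ∑ j, C⁻¹ i j = ∑ j, ∑ i, C⁻¹ i j := Finset.sum_comm
    _ = ∑ j, y j := by
        rw [hinv]; simp [Matrix.vecMul, dotProduct]
    _ = _ := by rw [hsum, suffixProd_eq_Bsum_reverse, hc]; ring

/-- The order in which the exponents occur along the loop of monomials. -/
def loopEquiv (r : ℕ) : Fin (2 * r + 2 + 1) ≃ Fin (2 * r + 3) where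
  toFun m := ⟨if m.val = 0 then 2 * r + 2 else
    if m.val % 2 = 1 then r + (m.val + 1) / 2 else r + 1 - m.val / 2, by grind⟩
  invFun i := ⟨if i.val = 2 * r + 2 then 0 else
    if r + 1 ≤ i.val then 2 * (i.val - r) - 1 else 2 * (r + 1 - i.val), by grind⟩
  left_inv m := by ext; grind
  right_inv i := by ext; grind

theorem loopEquiv_val (r : ℕ) (m : Fin (2 * r + 2 + 1)) :
    (loopEquiv r m).val = if m.val = 0 then 2 * r + 2 else
      if m.val % 2 = 1 then r + (m.val + 1) / 2 else r + 1 - m.val / 2 := rfl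

theorem bexp_loopEquiv_succ (r : ℕ) (m : Fin (2 * r + 2)) :
    bexp r (loopEquiv r m.succ) =
      (Zl r (r + 1))[m.val]'(by rw [length_Zl]; omega) := by
  have h := getElem?_Zl r (r + 1) (m.val / 2) (by omega)
  rw [loopEquiv_val, Fin.val_succ, if_neg (by omega)]
  apply Option.some_injective
  rw [← List.getElem?_eq_getElem]
  rcases Nat.mod_two_eq_zero_or_one m.val with hm | hm
  · rw [if_pos (by omega), bexp, if_neg (by omega),
      show 2 * r + 1 - (r + (m.val + 1 + 1) / 2) = r - m.val / 2 by omega,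
      show r + (m.val + 1 + 1) / 2 - r - 1 = m.val / 2 by omega, ← h.1]
    congr 1
    omega
  · rw [if_neg (by omega), bexp, if_pos (by omega),
      show r + 1 - (m.val + 1) / 2 = r - m.val / 2 by omega, ← h.2]
    congr 1
    omega

theorem esserMatrix_loopEquiv_zero (r : ℕ) (i : Fin (2 * r + 2 + 1)) :
    esserMatrix r (loopEquiv r i) (loopEquiv r 0) =
      (if i = 0 then (wB r 0 : ℚ) else 0) + if i = Fin.last _ then 1 else 0 := by
  simp only [esserMatrix, Matrix.of_apply, loopEquiv_val, Fin.ext_iff, Fin.val_zero,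
    Fin.val_last]
  grind

theorem esserMatrix_loopEquiv_succ (r : ℕ) (i : Fin (2 * r + 2 + 1)) (m : Fin (2 * r + 2)) :
    esserMatrix r (loopEquiv r i) (loopEquiv r m.succ) =
      (if i = m.succ then (bexp r (loopEquiv r m.succ) : ℚ) else 0) +
        if i = m.castSucc then 1 else 0 := by
  rcases eq_or_ne i m.succ with rfl | h
  · have : (loopEquiv r m.succ).val ≤ 2 * r + 1 := by
      rw [loopEquiv_val, Fin.val_succ]
      grind
    simp [esserMatrix, this, Fin.ext_iff]
  · rw [if_neg h]
    simp only [esserMatrix, Matrix.of_apply, (loopEquiv r).injective.eq_iff, if_neg h]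
    simp only [loopEquiv_val, Fin.ext_iff, Fin.val_succ, Fin.val_castSucc] at h ⊢
    grind

/-- The odd-dimensional case of Lemma 5.2 of Esser–Totaro: the exponent matrix of
Esser's hypersurface `V` of dimension `n = 2r+1` is invertible over `ℚ` and the sum
of all entries of its inverse (the sum of the charges) equals 1, i.e. `V` is
Calabi–Yau. -/
theorem esser_hypersurface_is_calabi_yau (r : ℕ) (hr : 1 ≤ r) :
    (esserMatrix r).det ≠ 0 ∧ ∑ i, ∑ j, (esserMatrix r)⁻¹ i j = 1 := by
  let e := loopEquiv r
  let L := Zl r (r + 1)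
  have hw : wB r 0 = suffixBsum L - 1 := by
    simp [wB, TB, Lk, suffixBsum, sylv, L]
  have hid : wB r 0 * L.prod + 1 = Bsum L * Bsum L.reverse := by
    have := Zl_identity r (r + 1) le_rfl
    simp only [Nat.sub_self, sylv] at this
    rw [hw]
    linear_combination this
  obtain ⟨-, hB, hG⟩ := Zl_pos r (r + 1)
  have hidQ : (wB r 0 : ℚ) * L.prod + 1 = Bsum L * Bsum L.reverse := by exact_mod_cast hid
  have hD : (Bsum L : ℚ) * Bsum L.reverse ≠ 0 := by
    exact_mod_cast mul_ne_zero (zero_lt_one.trans_le hB).ne' (zero_lt_one.trans_le hG).ne'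
  obtain ⟨hdet, hsum⟩ := cyclic_det_ne_zero_and_sum_inv (L := L) (n := 2 * r + 2)
    (by rw [length_Zl]; ring) (by simp [parity_simps]) (wB r 0) ((esserMatrix r).submatrix e e)
    (fun y => by
      simp [Matrix.vecMul, dotProduct, e, esserMatrix_loopEquiv_zero, mul_add,
        Finset.sum_add_distrib, mul_comm])
    (fun y m => by
      simp [Matrix.vecMul, dotProduct, e, esserMatrix_loopEquiv_succ, mul_add,
        Finset.sum_add_distrib, mul_comm, bexp_loopEquiv_succ, L])
    (by rw [hidQ]; exact hD)
  refine ⟨fun h => hdet (by rw [← h]; exact Matrix.det_submatrix_equiv_self e _), ?_⟩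
  rw [Matrix.inv_submatrix_equiv] at hsum
  have hre : ∑ i, ∑ j, (esserMatrix r)⁻¹ i j =
      ∑ i, ∑ j, ((esserMatrix r)⁻¹.submatrix e e) i j := by
    rw [← e.sum_comp]
    exact Finset.sum_congr rfl fun i _ => (e.sum_comp _).symm
  rw [hre, hsum, hidQ, hw, mul_assoc, mul_div_assoc, div_self hD]
  push_cast
  ring
end

section
/- Let R be a commutative ring, let k ≥ 3 be an odd integer, and let e_1, …, e_k ∈ R. Let A be the k×k loop matrix over R with A_{i,i} = e_i for 1 ≤ i ≤ k, A_{i,i+1} = 1 for 1 ≤ i ≤ k−1, A_{k,1} = 1, and all other entries 0. Let M be the k×k matrix with M_{i,j} = (−1)^((j−i) mod k) · Π_{t=1}^{(i−1−j) mod k} e_{ι(j+t)}, where (·) mod k denotes the representative in {0, 1, …, k−1} and ι(x) denotes the representative of x modulo k lying in {1, …, k} (the product being empty, equal to 1, when (i−1−j) mod k = 0). Then A·M = (e_1 e_2 ⋯ e_k + 1)·I_k and M·A = (e_1 e_2 ⋯ e_k + 1)·I_k. (In particular, when e_1⋯e_k + 1 is invertible in R, the matrix A is invertible with A⁻¹ =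 (e_1⋯e_k + 1)⁻¹ M.) -/
theorem Nat.mod_eq_ite_of_lt_two_mul {a k : ℕ} (h : a < 2 * k) :
    a % k = if a < k then a else a - k := by
  split_ifs with h1
  · exact Nat.mod_eq_of_lt h1
  · rw [Nat.mod_eq_sub_mod (by omega), Nat.mod_eq_of_lt (by omega)]

/-- The product of a `k`-periodic sequence over a window of length `k` does not depend on
where the window starts. -/
theorem Function.Periodic.prod_range_add {R : Type*} [CommMonoid R] {f : ℕ → R} {k : ℕ}
    (hf : Function.Periodic f k) (j : ℕ) :
    ∏ t ∈ Finset.range k, f (j + t) = ∏ t ∈ Finset.range k, f t := by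
  induction j with
  | zero => simp
  | succ j ih =>
    rw [← ih]
    cases k with
    | zero => simp
    | succ k =>
      rw [Finset.prod_range_succ, Finset.prod_range_succ']
      congr 1
      · exact Finset.prod_congr rfl fun t _ => congrArg f (by omega)
      · rw [add_zero, ← hf j]
        exact congrArg f (by omega)

/-- Lemma 5.3 of Esser–Totaro (inverse of a loop matrix): for an odd `k ≥ 3`
and `e_1, …, e_k` in a commutative ring `R`, the loop matrix `A` (with diagonal
entries `e_i`, cyclic superdiagonal entries 1, and 0 elsewhere) satisfies
`A·M = M·A = (e_1⋯e_k + 1)·I`, where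
`M_{i,j} = (−1)^((j−i) mod k) · ∏_{t=1}^{(i−1−j) mod k} e_{(j+t) mod k}`
(indices taken cyclically). In particular, when `e_1⋯e_k + 1` is invertible,
`A⁻¹ = (e_1⋯e_k + 1)⁻¹ M`. -/
theorem loop_matrix_inverse {R : Type*} [CommRing R] (k : ℕ) (hk3 : 3 ≤ k)
    (hkodd : Odd k) (e : Fin k → R) (A M : Matrix (Fin k) (Fin k) R)
    (hA : ∀ i j : Fin k,
      A i j = if j = i then e i else if j.val = (i.val + 1) % k then 1 else 0)
    (hM : ∀ i j : Fin k,
      M i j = (-1 : R) ^ ((j.val + k - i.val) % k) *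
        ∏ t ∈ Finset.Icc 1 ((i.val + 2 * k - 1 - j.val) % k),
          e ⟨(j.val + t) % k, Nat.mod_lt _ (by omega)⟩) :
    A * M = (∏ i, e i + 1) • (1 : Matrix (Fin k) (Fin k) R) ∧
    M * A = (∏ i, e i + 1) • (1 : Matrix (Fin k) (Fin k) R) := by
  have hk : 0 < k := by omega
  set s : Fin k → Fin k := fun i => ⟨(i.val + 1) % k, Nat.mod_lt _ hk⟩ with hs
  have s_ne (i : Fin k) : s i ≠ i := by
    have := i.isLt
    intro h
    have h2 := congrArg Fin.val h
    simp only [hs] at h2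
    rw [Nat.mod_eq_ite_of_lt_two_mul (by omega)] at h2
    split_ifs at h2 <;> omega
  have s_inj : Function.Injective s := by
    intro a b h
    have := a.isLt
    have := b.isLt
    have h2 := congrArg Fin.val h
    simp only [hs] at h2
    rw [Nat.mod_eq_ite_of_lt_two_mul (by omega), Nat.mod_eq_ite_of_lt_two_mul (by omega)] at h2
    apply Fin.ext
    split_ifs at h2 <;> omega
  have hA' (i j : Fin k) :
      A i j = (if j = i then e i else 0) + (if j = s i then 1 else 0) := by
    rw [hA]
    have hiff : j.val = (i.val + 1) % k ↔ j = s i := by simp [hs, Fin.ext_iff]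
    simp only [hiff]
    by_cases h : j = i
    · subst h
      simp [(s_ne j).symm]
    · simp [h]
  set E : ℕ → R := fun n => e ⟨n % k, Nat.mod_lt _ hk⟩ with hE
  have hper : Function.Periodic E k := by
    intro n
    simp [hE]
  have hEval (i : Fin k) : e i = E i.val := by
    simp [hE, Nat.mod_eq_of_lt i.isLt]
  have hprod : ∏ t ∈ Finset.range k, E t = ∏ i, e i := by
    rw [Finset.prod_range]
    exact Finset.prod_congr rfl fun i _ => (hEval i).symm
  have hMval (i j : Fin k) (m : ℕ) (hm : m < k) (h : i.val = (j.val + m + 1) % k) :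
      M i j = (-1) ^ (k - 1 - m) * ∏ t ∈ Finset.range m, E (j.val + 1 + t) := by
    have := i.isLt
    have := j.isLt
    rw [Nat.mod_eq_ite_of_lt_two_mul (by omega)] at h
    have h1 : (j.val + k - i.val) % k = k - 1 - m := by
      rw [Nat.mod_eq_ite_of_lt_two_mul (by omega)]
      split_ifs at h ⊢ <;> omega
    have h2 : (i.val + 2 * k - 1 - j.val) % k = m := by
      rw [Nat.mod_eq_sub_mod (by omega), Nat.mod_eq_ite_of_lt_two_mul (by omega)]
      split_ifs at h ⊢ <;> omega
    rw [hM, h1, h2, ← Finset.Ico_add_one_right_eq_Icc, Finset.prod_Ico_eq_prod_range]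
    congr 1
    exact Finset.prod_congr rfl fun t _ => congrArg E (by omega)
  have hdist (i j : Fin k) : ∃ m < k, i.val = (j.val + m + 1) % k := by
    have := i.isLt
    have := j.isLt
    refine ⟨if j.val < i.val then i.val - j.val - 1 else i.val + k - j.val - 1,
      by split_ifs <;> omega, ?_⟩
    rw [Nat.mod_eq_ite_of_lt_two_mul (by split_ifs <;> omega)]
    split_ifs <;> omega
  have hdist_eq (i j : Fin k) (m : ℕ) (hm : m < k) (h : i.val = (j.val + m + 1) % k) :
      i = j ↔ m = k - 1 := by
    have := i.isLt
    have := j.isLt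
    rw [Nat.mod_eq_ite_of_lt_two_mul (by omega)] at h
    rw [Fin.ext_iff]
    split_ifs at h <;> omega
  have hsign : (-1 : R) ^ (k - 1) = 1 := (Nat.Odd.sub_odd hkodd odd_one).neg_one_pow
  have hdiag (i : Fin k) : e i * M i i = ∏ i, e i := by
    have h := hMval i i (k - 1) (by omega)
      (by rw [show i.val + (k - 1) + 1 = i.val + k by omega]
          simp [Nat.mod_eq_of_lt i.isLt])
    rw [h, ← hprod, ← hper.prod_range_add i.val, hEval i]
    obtain ⟨n, rfl⟩ : ∃ n, k = n + 1 := ⟨k - 1, by omega⟩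
    rw [Finset.prod_range_succ']
    simp only [Nat.add_sub_cancel, Nat.sub_self, pow_zero, one_mul, add_zero]
    rw [mul_comm]
    congr 1
    exact Finset.prod_congr rfl fun t _ => congrArg E (by omega)
  have hsucc (j : Fin k) : M (s j) j = 1 := by
    rw [hMval (s j) j 0 hk rfl]
    simpa using hsign
  have hpow (m : ℕ) (hm : m + 1 < k) :
      (-1 : R) ^ (k - 1 - m) = -(-1) ^ (k - 1 - (m + 1)) := by
    rw [show k - 1 - m = k - 1 - (m + 1) + 1 by omega, pow_succ, mul_neg_one]
  constructor
  · ext i j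
    have hsum : (A * M) i j = e i * M i j + M (s i) j := by
      simp [Matrix.mul_apply, hA', add_mul, Finset.sum_add_distrib]
    rw [hsum, Matrix.smul_apply, Matrix.one_apply, smul_eq_mul]
    by_cases hij : i = j
    · subst hij
      simp [hdiag, hsucc]
    · obtain ⟨m, hm, h⟩ := hdist i j
      have hm' : m + 1 < k := by
        have := mt (hdist_eq i j m hm h).mpr hij
        omega
      rw [hMval i j m hm h, hMval (s i) j (m + 1) hm' (by simp [hs, h, add_assoc]),
        Finset.prod_range_succ, hpow m hm', if_neg hij,
        show e i = E (j.val + 1 + m) by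
          rw [hEval, h, hper.map_mod_nat]
          exact congrArg E (by omega)]
      ring
  · ext i j
    obtain ⟨j, rfl⟩ := (Finite.injective_iff_surjective.mp s_inj) j
    have hsum : (M * A) i (s j) = M i (s j) * e (s j) + M i j := by
      simp [Matrix.mul_apply, hA', mul_add, Finset.sum_add_distrib, s_inj.eq_iff]
    rw [hsum, Matrix.smul_apply, Matrix.one_apply, smul_eq_mul]
    by_cases hij : i = s j
    · subst hij
      rw [mul_comm, hdiag, hsucc]
      simp
    · obtain ⟨m, hm, h⟩ := hdist i (s j)
      have hm' : m + 1 < k := by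
        have := mt (hdist_eq i (s j) m hm h).mpr hij
        omega
      have hshift (n : ℕ) : E ((s j).val + n) = E (j.val + 1 + n) := by
        simp [hE, hs]
      rw [hMval i (s j) m hm h, hMval i j (m + 1) hm'
          (by rw [h]; simp only [hs, add_assoc, Nat.mod_add_mod]; congr 1; omega),
        Finset.prod_range_succ', hpow m hm', if_neg hij, hEval (s j),
        show E (s j).val = E (j.val + 1 + 0) from hshift 0,
        Finset.prod_congr rfl fun t _ =>
          show E ((s j).val + 1 + t) = E (j.val + 1 + (t + 1)) by
            rw [add_assoc, hshift, add_comm 1 t]]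
      ring
end
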